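/- Suppose a group G = AB with A ∩ B ≤ Hᵢ ≤ A and A ∩ B ≤ Kᵢ ≤ B for i = 1,2. If H₁K₁ = H₂K₂ as sets, then H₁ = H₂ and K₁ = K₂. -/

import Mathlib

open scoped Pointwise

theorem aux_left {G : Type*} [Group G] (A B H₁ H₂ K₁ K₂ : Subgroup G)
    (hH₁A : H₁ ≤ A) (hH₂ : A ⊓ B ≤ H₂) (hH₂A : H₂ ≤ A) (hK₂B : K₂ ≤ B)
    (heq : (H₁ : Set G) * (K₁ : Set G) = (H₂ : Set G) * (K₂ : Set G)) : H₁ ≤ H₂ := by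
  intro x hx
  have h : x ∈ (H₁ : Set G) * (K₁ : Set G) :=
    Set.mem_mul.2 ⟨x, hx, 1, K₁.one_mem, mul_one x⟩
  rw [heq] at h
  obtain ⟨a, ha, b, hb, rfl⟩ := Set.mem_mul.1 h
  have hbA : b ∈ A := (A.mul_mem_cancel_left (hH₂A ha)).1 (hH₁A hx)
  exact H₂.mul_mem ha (hH₂ ⟨hbA, hK₂B hb⟩)

theorem aux_right {G : Type*} [Group G] (A B H₁ H₂ K₁ K₂ : Subgroup G)
    (hK₁B : K₁ ≤ B) (hK₂ : A ⊓ B ≤ K₂) (hK₂B : K₂ ≤ B) (hH₂A : H₂ ≤ A)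
    (heq : (H₁ : Set G) * (K₁ : Set G) = (H₂ : Set G) * (K₂ : Set G)) : K₁ ≤ K₂ := by
  intro x hx
  have h : x ∈ (H₁ : Set G) * (K₁ : Set G) :=
    Set.mem_mul.2 ⟨1, H₁.one_mem, x, hx, one_mul x⟩
  rw [heq] at h
  obtain ⟨a, ha, b, hb, rfl⟩ := Set.mem_mul.1 h
  have haB : a ∈ B := (B.mul_mem_cancel_right (hK₂B hb)).1 (hK₁B hx)
  exact K₂.mul_mem (hK₂ ⟨hH₂A ha, haB⟩) hb

theorem stmt9 {G : Type*} [Group G] (A B H₁ H₂ K₁ K₂ : Subgroup G)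
    (hG : ∀ g : G, ∃ a ∈ A, ∃ b ∈ B, g = a * b)
    (hH₁ : A ⊓ B ≤ H₁) (hH₁A : H₁ ≤ A) (hH₂ : A ⊓ B ≤ H₂) (hH₂A : H₂ ≤ A)
    (hK₁ : A ⊓ B ≤ K₁) (hK₁B : K₁ ≤ B) (hK₂ : A ⊓ B ≤ K₂) (hK₂B : K₂ ≤ B)
    (heq : (H₁ : Set G) * (K₁ : Set G) = (H₂ : Set G) * (K₂ : Set G)) :
    H₁ = H₂ ∧ K₁ = K₂ := by
  exact ⟨le_antisymm (aux_left A B H₁ H₂ K₁ K₂ hH₁A hH₂ hH₂A hK₂B heq)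
      (aux_left A B H₂ H₁ K₂ K₁ hH₂A hH₁ hH₁A hK₁B heq.symm),
    le_antisymm (aux_right A B H₁ H₂ K₁ K₂ hK₁B hK₂ hK₂B hH₂A heq)
      (aux_right A B H₂ H₁ K₂ K₁ hK₂B hK₁ hK₁B hH₁A heq.symm)⟩
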